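/- Assume ρ > 0, η > 0, L_c > 0. Then both B₆(k) and B₇(k) are positive definite for every real k ≠ 0 — equivalently, the block-diagonal Cosserat acoustic tensor diag(B₆(k), B₇(k), B₇(k)) is positive definite for every k ≠ 0 — if and only if 2μ + λ > 0, μ > 0 and μc ≥ 0. -/

import Mathlib

open Real

/-- The longitudinal block `B₆(k)` of the acoustic tensor of the isotropic Cosserat
(micropolar) model with uni-constant curvature. -/
noncomputable def B6 (μ lam μc ρ η Lc k : ℝ) : Matrix (Fin 2) (Fin 2) ℝ :=
  Matrix.diagonal ![k ^ 2 * (2 * μ + lam) / ρ, (2 * μ * Lc ^ 2 * k ^ 2 + 2 * μc) / η]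

/-- The transverse block `B₇(k)` of the acoustic tensor of the isotropic Cosserat
(micropolar) model with uni-constant curvature. -/
noncomputable def B7 (μ μc ρ η Lc k : ℝ) : Matrix (Fin 2) (Fin 2) ℝ :=
  !![k ^ 2 * (μ + μc) / ρ, Real.sqrt 2 * k * μc / Real.sqrt (ρ * η);
     Real.sqrt 2 * k * μc / Real.sqrt (ρ * η), (k ^ 2 * μ * Lc ^ 2 + 4 * μc) / (2 * η)]

open scoped Matrix

/-- Sylvester's criterion for real symmetric `2 × 2` matrices. -/
theorem posDef_fin_two_iff (a b c : ℝ) :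
    (!![a, b; b, c] : Matrix (Fin 2) (Fin 2) ℝ).PosDef ↔ 0 < a ∧ 0 < a * c - b ^ 2 := by
  constructor
  · intro h
    have hdet := h.det_pos
    rw [Matrix.det_fin_two_of] at hdet
    exact ⟨h.diag_pos (i := 0), by linarith [sq b]⟩
  · rintro ⟨ha, hdet⟩
    refine Matrix.PosDef.of_dotProduct_mulVec_pos ?_ fun x hx => ?_
    · ext i j
      fin_cases i <;> fin_cases j <;> rfl
    · have hform : star x ⬝ᵥ (!![a, b; b, c] *ᵥ x) =
          ((a * x 0 + b * x 1) ^ 2 + (a * c - b ^ 2) * x 1 ^ 2) / a := by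
        simp [Matrix.mulVec, dotProduct, Fin.sum_univ_two]
        field_simp
        ring
      rw [hform]
      refine div_pos ?_ ha
      by_cases h1 : x 1 = 0
      · have h0 : x 0 ≠ 0 := fun h0 => hx (by ext i; fin_cases i <;> assumption)
        rw [h1]
        have : a * x 0 ≠ 0 := mul_ne_zero ha.ne' h0
        simpa using sq_pos_of_ne_zero this
      · positivity

theorem B6_posDef_iff {μ lam μc ρ η Lc k : ℝ} (hρ : 0 < ρ) (hη : 0 < η) (hk : k ≠ 0) :
    (B6 μ lam μc ρ η Lc k).PosDef ↔ 0 < 2 * μ + lam ∧ 0 < μ * Lc ^ 2 * k ^ 2 + μc := by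
  have hk2 : 0 < k ^ 2 := by positivity
  have hfac : 2 * μ * Lc ^ 2 * k ^ 2 + 2 * μc = 2 * (μ * Lc ^ 2 * k ^ 2 + μc) := by ring
  simp [B6, Matrix.posDef_diagonal_iff, Fin.forall_fin_two, hfac, div_pos_iff_of_pos_right, hρ,
    hη, hk2]

theorem B7_posDef_iff {μ μc ρ η Lc k : ℝ} (hρ : 0 < ρ) (hη : 0 < η) (hk : k ≠ 0) :
    (B7 μ μc ρ η Lc k).PosDef ↔
      0 < μ + μc ∧ 0 < μ * (Lc ^ 2 * k ^ 2 * (μ + μc) + 4 * μc) := by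
  have hk2 : 0 < k ^ 2 := by positivity
  have hdet : k ^ 2 * (μ + μc) / ρ * ((k ^ 2 * μ * Lc ^ 2 + 4 * μc) / (2 * η)) -
      (√2 * k * μc / √(ρ * η)) ^ 2 =
      k ^ 2 / (2 * ρ * η) * (μ * (Lc ^ 2 * k ^ 2 * (μ + μc) + 4 * μc)) := by
    rw [div_pow, mul_pow, mul_pow, Real.sq_sqrt zero_le_two, Real.sq_sqrt (by positivity)]
    field_simp
    ring
  rw [B7, posDef_fin_two_iff, hdet, mul_pos_iff_of_pos_left (by positivity),
    div_pos_iff_of_pos_right hρ, mul_pos_iff_of_pos_left hk2]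

/-- Necessary and sufficient condition for both blocks `B₆(k)` and `B₇(k)` of the
Cosserat acoustic tensor (equivalently, for the block-diagonal acoustic tensor
`diag(B₆, B₇, B₇)`) to be positive definite for every real `k ≠ 0`:
`2μ + λ > 0`, `μ > 0` and `μc ≥ 0`. -/
theorem cosserat_acoustic_posDef_iff (μ lam μc ρ η Lc : ℝ)
    (hρ : ρ > 0) (hη : η > 0) (hLc : Lc > 0) :
    (∀ k : ℝ, k ≠ 0 →
      (B6 μ lam μc ρ η Lc k).PosDef ∧ (B7 μ μc ρ η Lc k).PosDef) ↔
    2 * μ + lam > 0 ∧ μ > 0 ∧ μc ≥ 0 := by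
  constructor
  · intro h
    have hB6 : ∀ k : ℝ, k ≠ 0 → 0 < 2 * μ + lam ∧ 0 < μ * Lc ^ 2 * k ^ 2 + μc :=
      fun k hk => (B6_posDef_iff hρ hη hk).1 (h k hk).1
    have hlong := (hB6 1 one_ne_zero).1
    obtain ⟨hsum, hdet⟩ := (B7_posDef_iff hρ hη one_ne_zero).1 (h 1 one_ne_zero).2
    have hμc : 0 ≤ μc := by
      by_contra! hneg
      have hμ : 0 < μ := by linarith
      have hpos : 0 < -μc / (μ * Lc ^ 2) := div_pos (by linarith) (by positivity)
      have hroot := (hB6 _ (Real.sqrt_pos.2 hpos).ne').2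
      rw [Real.sq_sqrt hpos.le, mul_div_cancel₀ _ (by positivity)] at hroot
      linarith
    exact ⟨hlong, pos_of_mul_pos_left hdet (by positivity), hμc⟩
  · rintro ⟨hlong, hμ, hμc⟩ k hk
    rw [B6_posDef_iff hρ hη hk, B7_posDef_iff hρ hη hk]
    exact ⟨⟨hlong, by positivity⟩, by positivity, by positivity⟩
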